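/- For any tree T with at least 2 edges, there exist a constant c > 0 and n₀ such that for all n ≥ n₀, f₃(n,T) ≤ c·n^{3/2}. Consequently, combined with the lower bound f₃(n,T) = Ω(n^{3/2}), one has f₃(n,T) = Θ(n^{3/2}) for every tree T with at least two edges. -/

import Mathlib

open Finset

/-- `c` is a proper edge colouring of the complete graph on `Fin n`:
it is symmetric and edges sharing a vertex receive distinct colours. -/
def IsProperEdgeColoring (n : ℕ) (c : Fin n → Fin n → ℕ) : Prop :=
  (∀ a b, c a b = c b a) ∧
    ∀ a b b', a ≠ b → a ≠ b' → b ≠ b' → c a b ≠ c a b'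

/-- The number of colours used by `c` on the edges of the complete graph on `Fin n`. -/
def numColors (n : ℕ) (c : Fin n → Fin n → ℕ) : ℕ :=
  ((Finset.univ.filter fun p : Fin n × Fin n => p.1 ≠ p.2).image fun p => c p.1 p.2).card

/-- The edge colouring `c` of the complete graph on `Fin n` contains `k` pairwise
vertex-disjoint, pairwise colour-isomorphic copies of `H`. -/
def HasRepeat (n k : ℕ) {V : Type*} (H : SimpleGraph V) (c : Fin n → Fin n → ℕ) : Prop :=
  ∃ φ : Fin k → V → Fin n,
    (∀ i, Function.Injective (φ i)) ∧
    (∀ i j, i ≠ j → ∀ u v, φ i u ≠ φ j v) ∧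
    (∀ i j, ∀ u v, H.Adj u v → c (φ i u) (φ i v) = c (φ j u) (φ j v))

/-- `repeatNumber k n H` is `f_k(n,H)`: the smallest number of colours `C` such that there
is a proper edge colouring of `K_n` with `C` colours containing no `k` pairwise
vertex-disjoint, pairwise colour-isomorphic copies of `H`. -/
noncomputable def repeatNumber (k n : ℕ) {V : Type*} (H : SimpleGraph V) : ℕ :=
  sInf { C | ∃ c : Fin n → Fin n → ℕ,
    IsProperEdgeColoring n c ∧ numColors n c = C ∧ ¬ HasRepeat n k H c }

/-- A symmetric relation with many related pairs has a nonempty subset on which every element is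
related to more than `D` elements. -/
lemma exists_subset_forall_lt_card_filter {W : Type*} [DecidableEq W] [Fintype W]
    (R : W → W → Prop) [DecidableRel R] (hsymm : ∀ x y, R x y → R y x) (D : ℕ)
    (h : 2 * D * Fintype.card W < #{p : W × W | R p.1 p.2}) :
    ∃ S : Finset W, S.Nonempty ∧ ∀ x ∈ S, D < #{y ∈ S | R x y} := by
  obtain ⟨S, hS, hmin⟩ := exists_minimal_of_wellFoundedLT
    (fun S : Finset W => 2 * D * #S < #{p ∈ S ×ˢ S | R p.1 p.2}) ⟨univ, by simpa using h⟩
  refine ⟨S, ?_, fun x hx => ?_⟩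
  · rw [Finset.nonempty_iff_ne_empty]
    rintro rfl
    simp at hS
  · have hsub : {p ∈ S ×ˢ S | R p.1 p.2} ⊆
        {p ∈ S.erase x ×ˢ S.erase x | R p.1 p.2} ∪
          (({y ∈ S | R x y}.image fun y => (x, y)) ∪ {y ∈ S | R x y}.image fun y => (y, x)) := by
      rintro ⟨a, b⟩ hp
      simp only [mem_filter, mem_product, mem_union, mem_image, mem_erase, Prod.mk.injEq] at hp ⊢
      by_cases ha : a = x
      · exact Or.inr (Or.inl ⟨b, ⟨hp.1.2, ha ▸ hp.2⟩, ha.symm, rfl⟩)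
      by_cases hb : b = x
      · exact Or.inr (Or.inr ⟨a, ⟨hp.1.1, hsymm _ _ (hb ▸ hp.2)⟩, rfl, hb.symm⟩)
      exact Or.inl ⟨⟨⟨ha, hp.1.1⟩, hb, hp.1.2⟩, hp.2⟩
    have h1 := card_le_card hsub
    have h2 := card_union_le {p ∈ S.erase x ×ˢ S.erase x | R p.1 p.2}
          (({y ∈ S | R x y}.image fun y => (x, y)) ∪ {y ∈ S | R x y}.image fun y => (y, x))
    have h3 := card_union_le ({y ∈ S | R x y}.image fun y => (x, y))
      ({y ∈ S | R x y}.image fun y => (y, x))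
    have h4 : #({y ∈ S | R x y}.image fun y => (x, y)) ≤ #{y ∈ S | R x y} := card_image_le
    have h5 : #({y ∈ S | R x y}.image fun y => (y, x)) ≤ #{y ∈ S | R x y} := card_image_le
    have h6 : ¬ 2 * D * #(S.erase x) < #{p ∈ S.erase x ×ˢ S.erase x | R p.1 p.2} := fun h6 =>
      notMem_erase x S (hmin h6 (erase_subset x S) hx)
    have h7 : #S = #(S.erase x) + 1 := (card_erase_add_one hx).symm
    rw [h7, mul_add] at hS
    omega

/-- `x` and `y` are triples of distinct vertices and the edges `x i — y i` all have the same
colour. -/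
def TripleAdj {n : ℕ} (c : Fin n → Fin n → ℕ) (x y : Fin 3 → Fin n) : Prop :=
  Function.Injective x ∧ Function.Injective y ∧ (∀ i, x i ≠ y i) ∧
    ∀ i j, c (x i) (y i) = c (x j) (y j)

lemma TripleAdj.symm {n : ℕ} {c : Fin n → Fin n → ℕ} (hc : IsProperEdgeColoring n c)
    {x y : Fin 3 → Fin n} (h : TripleAdj c x y) : TripleAdj c y x :=
  ⟨h.2.1, h.1, fun i => (h.2.2.1 i).symm, fun i j => by
    rw [hc.1 (y i), hc.1 (y j)]; exact h.2.2.2 i j⟩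

lemma IsProperEdgeColoring.eq_of_eq {n : ℕ} {c : Fin n → Fin n → ℕ}
    (hc : IsProperEdgeColoring n c) {a b b' : Fin n} (hb : a ≠ b) (hb' : a ≠ b')
    (h : c a b = c a b') : b = b' := by
  by_contra hne
  exact hc.2 a b b' hb hb' hne h

lemma TripleAdj.eq_of_eq_apply {n : ℕ} {c : Fin n → Fin n → ℕ} (hc : IsProperEdgeColoring n c)
    {x y z : Fin 3 → Fin n} (hy : TripleAdj c x y) (hz : TripleAdj c x z) {i : Fin 3}
    (h : y i = z i) : y = z := by
  funext j
  refine hc.eq_of_eq (hy.2.2.1 j) (hz.2.2.1 j) ?_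
  rw [hy.2.2.2 j i, hz.2.2.2 j i, h]

open Classical in
/-- A large set of neighbours of a triple contains one avoiding a small set of vertices. -/
lemma exists_tripleAdj_avoiding {n : ℕ} {c : Fin n → Fin n → ℕ} (hc : IsProperEdgeColoring n c)
    (x : Fin 3 → Fin n) (S : Finset (Fin 3 → Fin n)) (U : Finset (Fin n))
    (h : 3 * #U < #{y ∈ S | TripleAdj c x y}) :
    ∃ y ∈ S, TripleAdj c x y ∧ ∀ i, y i ∉ U := by
  by_contra! hcon
  have hsub : {y ∈ S | TripleAdj c x y} ⊆
      (univ ×ˢ U : Finset (Fin 3 × Fin n)).biUnion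
        fun p => {y ∈ S | TripleAdj c x y ∧ y p.1 = p.2} := by
    intro y hy
    rw [mem_filter] at hy
    obtain ⟨i, hi⟩ := hcon y hy.1 hy.2
    simp only [mem_biUnion, mem_filter]
    exact ⟨(i, y i), by simpa using hi, hy.1, hy.2, rfl⟩
  have h1 := (card_le_card hsub).trans (card_biUnion_le_card_mul _ _ 1 fun p _ => by
    rw [card_le_one]
    intro y hy z hz
    rw [mem_filter] at hy hz
    exact hy.2.1.eq_of_eq_apply hc hz.2.1 (hy.2.2.trans hz.2.2.symm))
  simp only [card_product, card_univ, Fintype.card_fin] at h1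
  omega

open Classical in
lemma exists_tree_embedding {n : ℕ} {c : Fin n → Fin n → ℕ} (hc : IsProperEdgeColoring n c)
    {S : Finset (Fin 3 → Fin n)} (hS : S.Nonempty) {D : ℕ}
    (hD : ∀ x ∈ S, D < #{y ∈ S | TripleAdj c x y}) (m : ℕ) :
    ∀ (V : Type) [Fintype V] (T : SimpleGraph V), T.IsTree → Fintype.card V = m → 9 * m ≤ D →
      ∃ φ : V → Fin 3 → Fin n, (∀ v, φ v ∈ S) ∧
        (Function.Injective fun p : V × Fin 3 => φ p.1 p.2) ∧
        ∀ u v, T.Adj u v → TripleAdj c (φ u) (φ v) := by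
  induction m with
  | zero =>
    intro V _ T hT hV
    have := hT.connected.nonempty
    exact absurd hV Fintype.card_ne_zero
  | succ m ih =>
    intro V _ T hT hV hm
    cases subsingleton_or_nontrivial V with
    | inl hsub =>
      obtain ⟨x, hx⟩ := hS
      obtain ⟨y, hy⟩ := card_pos.1 ((Nat.zero_le D).trans_lt (hD x hx))
      refine ⟨fun _ => x, fun _ => hx, ?_, fun u v huv => absurd (Subsingleton.elim u v) huv.ne⟩
      rintro ⟨u, i⟩ ⟨v, j⟩ h
      exact Prod.ext (Subsingleton.elim u v) ((mem_filter.1 hy).2.1 h)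
    | inr hnon =>
      obtain ⟨v, hv⟩ := hT.exists_vert_degree_one_of_nontrivial
      have hT' : (T.induce {v}ᶜ).IsTree :=
        ⟨hT.connected.induce_compl_singleton_of_degree_eq_one hv, hT.isAcyclic.induce _⟩
      have hcard : Fintype.card ({v}ᶜ : Set V) = m := by
        rw [Fintype.card_compl_set]; simp [hV]
      obtain ⟨ψ, hψS, hψinj, hψ⟩ := ih _ (T.induce {v}ᶜ) hT' hcard (by omega)
      obtain ⟨u, huv, hu⟩ := SimpleGraph.degree_eq_one_iff_existsUnique_adj.1 hv
      obtain ⟨y, hyS, hy, hyU⟩ := exists_tripleAdj_avoiding hc (ψ ⟨u, huv.ne'⟩) S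
        (univ.image fun p : ({v}ᶜ : Set V) × Fin 3 => ψ p.1 p.2)
        ((Nat.mul_le_mul_left 3 card_image_le).trans_lt (lt_of_le_of_lt (by
          rw [card_univ, Fintype.card_prod, hcard, Fintype.card_fin]; omega) (hD _ (hψS _))))
      have hyψ : ∀ i w j, y i ≠ ψ w j := fun i w j h =>
        hyU i (mem_image.2 ⟨(w, j), mem_univ _, h.symm⟩)
      refine ⟨fun w => if h : w = v then y else ψ ⟨w, h⟩, fun w => ?_, ?_, fun a b hab => ?_⟩
      · by_cases h : w = v
        · simpa [h] using hyS
        · simpa [h] using hψS _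
      · rintro ⟨a, i⟩ ⟨b, j⟩ h
        by_cases ha : a = v <;> by_cases hb : b = v
        · subst ha hb
          simp only [dite_true] at h
          rw [hy.2.1 h]
        · simp only [ha, hb, dite_true, dite_false] at h
          exact absurd h (hyψ _ _ _)
        · simp only [ha, hb, dite_true, dite_false] at h
          exact absurd h.symm (hyψ _ _ _)
        · simp only [ha, hb, dite_false] at h
          have := @hψinj (⟨a, ha⟩, i) (⟨b, hb⟩, j) h
          simp only [Prod.mk.injEq] at this
          exact Prod.ext (Subtype.ext_iff.1 this.1) this.2
      · by_cases ha : a = v <;> by_cases hb : b = v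
        · exact absurd (ha.trans hb.symm) hab.ne
        · subst ha
          obtain rfl := hu b hab
          simpa [hb] using hy.symm hc
        · subst hb
          obtain rfl := hu a hab.symm
          simpa [ha] using hy
        · simpa [ha, hb] using hψ ⟨a, ha⟩ ⟨b, hb⟩ hab

open Classical in
lemma hasRepeat_of_card_tripleAdj {n : ℕ} {c : Fin n → Fin n → ℕ}
    (hc : IsProperEdgeColoring n c) {V : Type} [Fintype V] {T : SimpleGraph V} (hT : T.IsTree)
    (h : 2 * (9 * Fintype.card V) * n ^ 3 <
      #{p : (Fin 3 → Fin n) × (Fin 3 → Fin n) | TripleAdj c p.1 p.2}) :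
    HasRepeat n 3 T c := by
  obtain ⟨S, hS, hD⟩ := exists_subset_forall_lt_card_filter (TripleAdj c)
    (fun x y hxy => hxy.symm hc) (9 * Fintype.card V) (by simpa using h)
  obtain ⟨φ, -, hinj, hφ⟩ := exists_tree_embedding hc hS hD _ V T hT rfl le_rfl
  refine ⟨fun i v => φ v i, fun i u v huv => ?_, fun i j hij u v huv => ?_,
    fun i j u v huv => (hφ u v huv).2.2.2 i j⟩
  · exact (Prod.ext_iff.1 (@hinj (u, i) (v, i) huv)).1
  · exact hij (Prod.ext_iff.1 (@hinj (u, i) (v, j) huv)).2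

lemma sq_mul_le_descFactorial_add {K : ℕ} (hK : 2 ≤ K) (d : ℕ) :
    K ^ 2 * d ≤ d.descFactorial 3 + 2 * K ^ 3 := by
  rcases le_total d (2 * K) with h | h
  · calc K ^ 2 * d ≤ K ^ 2 * (2 * K) := Nat.mul_le_mul_left _ h
      _ = 2 * K ^ 3 := by ring
      _ ≤ _ := Nat.le_add_left _ _
  · have h1 : d.descFactorial 3 = (d - 2) * ((d - 1) * d) := by simp [Nat.descFactorial]
    have h2 : K * (K * d) ≤ (d - 2) * ((d - 1) * d) :=
      Nat.mul_le_mul (by omega) (Nat.mul_le_mul_right _ (by omega))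
    rw [h1]
    calc K ^ 2 * d = K * (K * d) := by ring
      _ ≤ _ := h2.trans (Nat.le_add_right _ _)

open Classical in
/-- Triples of distinct oriented edges of a common colour give pairs of adjacent triples. -/
lemma descFactorial_le_card_tripleAdj {n : ℕ} {c : Fin n → Fin n → ℕ}
    (hc : IsProperEdgeColoring n c) (γ : ℕ) :
    (#{p : Fin n × Fin n | p.1 ≠ p.2 ∧ c p.1 p.2 = γ}).descFactorial 3 ≤
      #{p : (Fin 3 → Fin n) × (Fin 3 → Fin n) |
        TripleAdj c p.1 p.2 ∧ c (p.1 0) (p.2 0) = γ} := by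
  set M : Finset (Fin n × Fin n) := {p | p.1 ≠ p.2 ∧ c p.1 p.2 = γ} with hM
  have hMmem : ∀ p : M, p.1.1 ≠ p.1.2 ∧ c p.1.1 p.1.2 = γ := fun p =>
    (mem_filter.1 p.2).2
  have hcard : (#M).descFactorial 3 = Fintype.card (Fin 3 ↪ M) := by
    rw [Fintype.card_embedding_eq]; simp
  rw [hcard, ← Finset.card_univ]
  refine card_le_card_of_injOn (fun e => (fun i => (e i).1.1, fun i => (e i).1.2)) ?_ ?_
  · intro e _
    simp only [coe_filter, mem_univ, true_and, Set.mem_ofPred_eq]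
    refine ⟨⟨fun i j hij => e.injective (Subtype.ext (Prod.ext hij ?_)),
      fun i j hij => e.injective (Subtype.ext (Prod.ext ?_ hij)),
      fun i => (hMmem _).1, fun i j => (hMmem _).2.trans (hMmem _).2.symm⟩, (hMmem _).2⟩
    · have hij' : (e i).1.1 = (e j).1.1 := hij
      refine hc.eq_of_eq (hMmem (e i)).1 (hij' ▸ (hMmem (e j)).1) ?_
      rw [(hMmem (e i)).2, hij', (hMmem (e j)).2]
    · have hij' : (e i).1.2 = (e j).1.2 := hij
      refine hc.eq_of_eq (hMmem (e i)).1.symm (hij' ▸ (hMmem (e j)).1.symm) ?_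
      rw [hc.1, (hMmem (e i)).2, hij', hc.1, (hMmem (e j)).2]
  · intro e _ f _ hef
    simp only [Prod.mk.injEq] at hef
    exact DFunLike.ext _ _ fun i =>
      Subtype.ext (Prod.ext (congrFun hef.1 i) (congrFun hef.2 i))

open Classical in
lemma card_tripleAdj_lower_bound {n : ℕ} {c : Fin n → Fin n → ℕ}
    (hc : IsProperEdgeColoring n c) {K : ℕ} (hK : 2 ≤ K) :
    K ^ 2 * (n * (n - 1)) ≤
      #{p : (Fin 3 → Fin n) × (Fin 3 → Fin n) | TripleAdj c p.1 p.2} +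
        2 * K ^ 3 * numColors n c := by
  set E : Finset (Fin n × Fin n) := {p | p.1 ≠ p.2} with hE
  set C : Finset ℕ := E.image fun p => c p.1 p.2 with hC
  have hEcard : #E = n * (n - 1) := by
    have : E = (univ : Finset (Fin n)).offDiag := by ext p; simp [hE]
    rw [this, offDiag_card]
    simp [Nat.mul_sub]
  have hCcard : numColors n c = #C := by unfold numColors; congr!
  have hsumE : #E = ∑ γ ∈ C, #{p : Fin n × Fin n | p.1 ≠ p.2 ∧ c p.1 p.2 = γ} := by
    rw [card_eq_sum_card_fiberwise (f := fun p => c p.1 p.2) (t := C)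
      fun p hp => mem_image_of_mem _ hp]
    simp only [hE, filter_filter]
  have hsumP : #{p : (Fin 3 → Fin n) × (Fin 3 → Fin n) | TripleAdj c p.1 p.2} =
      ∑ γ ∈ C, #{p : (Fin 3 → Fin n) × (Fin 3 → Fin n) |
        TripleAdj c p.1 p.2 ∧ c (p.1 0) (p.2 0) = γ} := by
    rw [card_eq_sum_card_fiberwise
      (f := fun p : (Fin 3 → Fin n) × (Fin 3 → Fin n) => c (p.1 0) (p.2 0)) (t := C)]
    · simp only [filter_filter]
    · intro p hp
      have hp' : TripleAdj c p.1 p.2 := by simpa using hp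
      exact mem_image.2 ⟨(p.1 0, p.2 0), by simpa [hE] using hp'.2.2.1 0, rfl⟩
  rw [← hEcard, hsumE, hsumP, hCcard, mul_sum, mul_comm (2 * K ^ 3), ← smul_eq_mul (#C),
    ← sum_const, ← sum_add_distrib]
  exact sum_le_sum fun γ _ => (sq_mul_le_descFactorial_add hK _).trans
    (Nat.add_le_add_right (descFactorial_le_card_tripleAdj hc γ) _)

/-- The colour of the edge `uv` in the plane over a field: `u + v` together with the bilinear form
`u₁ v₁ - a u₂ v₂`. Edges of a given colour join antipodal points of a conic. -/
def antipodalColor {F : Type*} [Field F] (a : F) (u v : F × F) : (F × F) × F :=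
  (u + v, u.1 * v.1 - a * (u.2 * v.2))

lemma antipodalColor_comm {F : Type*} [Field F] (a : F) (u v : F × F) :
    antipodalColor a u v = antipodalColor a v u := by
  simp only [antipodalColor, Prod.mk.injEq]
  exact ⟨add_comm _ _, by ring⟩

lemma eq_of_antipodalColor_eq {F : Type*} [Field F] {a : F} {u v w : F × F}
    (h : antipodalColor a u v = antipodalColor a u w) : v = w :=
  add_left_cancel (Prod.ext_iff.1 h).1

lemma sq_sub_mul_sq_ne_zero {F : Type*} [Field F] {a : F} (ha : ¬ IsSquare a) {d₁ d₂ : F}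
    (hd : d₁ ≠ 0 ∨ d₂ ≠ 0) : d₁ ^ 2 - a * d₂ ^ 2 ≠ 0 := by
  intro h
  by_cases h2 : d₂ = 0
  · subst h2
    simp at h hd
    exact hd h
  · refine ha ⟨d₁ / d₂, ?_⟩
    field_simp
    linear_combination -h

/-- Points orthogonal to `d` for the form `x₁ y₁ - a x₂ y₂` are multiples of `(a d₂, d₁)`. -/
lemma exists_eq_mul_of_orthogonal {F : Type*} [Field F] {a : F} (ha : a ≠ 0) {d₁ d₂ x₁ x₂ : F}
    (hd : d₁ ≠ 0 ∨ d₂ ≠ 0) (h : x₁ * d₁ = a * (x₂ * d₂)) :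
    ∃ l, x₁ = l * (a * d₂) ∧ x₂ = l * d₁ := by
  by_cases h1 : d₁ = 0
  · subst h1
    have h2 : d₂ ≠ 0 := by simpa using hd
    have hx : x₂ = 0 := by simpa [ha, h2] using h
    exact ⟨x₁ / (a * d₂), by field_simp, by simp [hx]⟩
  · exact ⟨x₂ / d₁, by field_simp; linear_combination h, by field_simp⟩

/-- At most two points are incident with edges of two given distinct colours. -/
lemma eq_or_eq_or_eq_of_antipodalColor {F : Type*} [Field F] {a : F} (ha : ¬ IsSquare a)
    {x y z : Fin 3 → F × F} (hyz : y 0 ≠ z 0)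
    (hy : ∀ i j, antipodalColor a (x i) (y i) = antipodalColor a (x j) (y j))
    (hz : ∀ i j, antipodalColor a (x i) (z i) = antipodalColor a (x j) (z j)) :
    x 1 = x 0 ∨ x 2 = x 0 ∨ x 1 = x 2 := by
  have ha0 : a ≠ 0 := fun h => ha (h ▸ IsSquare.zero)
  have hd : (y 0).1 - (z 0).1 ≠ 0 ∨ (y 0).2 - (z 0).2 ≠ 0 := by
    by_contra! h
    exact hyz (Prod.ext (sub_eq_zero.1 h.1) (sub_eq_zero.1 h.2))
  have hQ := sq_sub_mul_sq_ne_zero ha hd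
  have key : ∀ i, ∃ l : F, (x i).1 = (x 0).1 + l * (a * ((y 0).2 - (z 0).2)) ∧
      (x i).2 = (x 0).2 + l * ((y 0).1 - (z 0).1) ∧
      l * (l * (a * (((y 0).1 - (z 0).1) ^ 2 - a * ((y 0).2 - (z 0).2) ^ 2)) +
        (a * ((y 0).2 - (z 0).2) * ((y 0).1 - (x 0).1) -
          a * ((y 0).1 - (z 0).1) * ((y 0).2 - (x 0).2))) = 0 := by
    intro i
    have h1 := hy i 0
    have h2 := hz i 0
    simp only [antipodalColor, Prod.ext_iff, Prod.fst_add, Prod.snd_add] at h1 h2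
    obtain ⟨⟨h11, h12⟩, h13⟩ := h1
    obtain ⟨⟨h21, h22⟩, h23⟩ := h2
    have ey1 : (y i).1 = (x 0).1 + (y 0).1 - (x i).1 := by linear_combination h11
    have ey2 : (y i).2 = (x 0).2 + (y 0).2 - (x i).2 := by linear_combination h12
    have ez1 : (z i).1 = (x 0).1 + (z 0).1 - (x i).1 := by linear_combination h21
    have ez2 : (z i).2 = (x 0).2 + (z 0).2 - (x i).2 := by linear_combination h22
    rw [ey1, ey2] at h13
    rw [ez1, ez2] at h23
    obtain ⟨l, hl1, hl2⟩ := exists_eq_mul_of_orthogonal (x₁ := (x i).1 - (x 0).1)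
      (x₂ := (x i).2 - (x 0).2) ha0 hd (by linear_combination h13 - h23)
    have e1 : (x i).1 = (x 0).1 + l * (a * ((y 0).2 - (z 0).2)) := by linear_combination hl1
    have e2 : (x i).2 = (x 0).2 + l * ((y 0).1 - (z 0).1) := by linear_combination hl2
    refine ⟨l, e1, e2, ?_⟩
    rw [e1, e2] at h13
    linear_combination h13
  obtain ⟨l, hl1, hl2, hl⟩ := key 1
  obtain ⟨m, hm1, hm2, hm⟩ := key 2
  by_cases l0 : l = 0
  · exact Or.inl (Prod.ext (by simp [hl1, l0]) (by simp [hl2, l0]))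
  by_cases m0 : m = 0
  · exact Or.inr (Or.inl (Prod.ext (by simp [hm1, m0]) (by simp [hm2, m0])))
  have hlm : l = m := by
    have h1 := (mul_eq_zero.1 hl).resolve_left l0
    have h2 := (mul_eq_zero.1 hm).resolve_left m0
    exact mul_right_cancel₀ (mul_ne_zero ha0 hQ) (by linear_combination h1 - h2)
  exact Or.inr (Or.inr (Prod.ext (by rw [hl1, hm1, hlm]) (by rw [hl2, hm2, hlm])))

lemma SimpleGraph.IsTree.exists_adj_adj_ne {V : Type*} [Fintype V] {T : SimpleGraph V}
    [Fintype T.edgeSet] (hT : T.IsTree) (hm : 2 ≤ #T.edgeFinset) :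
    ∃ u v w, T.Adj u v ∧ T.Adj u w ∧ v ≠ w := by
  classical
  by_contra! h
  have hdeg : ∀ v, T.degree v ≤ 1 := fun u => by
    rw [← T.card_neighborFinset_eq_degree, card_le_one]
    intro v hv w hw
    exact h u v w (by simpa using hv) (by simpa using hw)
  have h1 := T.sum_degrees_eq_twice_card_edges
  have h2 := hT.card_edgeFinset
  have h3 : ∑ v, T.degree v ≤ Fintype.card V := by
    simpa using sum_le_sum fun v (_ : v ∈ univ) => hdeg v
  have h4 : #T.edgeFinset = Finset.card (@SimpleGraph.edgeFinset V T (T.fintypeEdgeSet)) := by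
    congr!
  omega

lemma exists_coloring_not_hasRepeat {V : Type*} [Fintype V] {T : SimpleGraph V}
    [Fintype T.edgeSet] (hT : T.IsTree) (hm : 2 ≤ #T.edgeFinset) {n p : ℕ} (hp : p.Prime)
    (hp2 : p ≠ 2) (hn : n ≤ p ^ 2) :
    ∃ c, IsProperEdgeColoring n c ∧ numColors n c ≤ p ^ 3 ∧ ¬ HasRepeat n 3 T c := by
  classical
  have := Fact.mk hp
  obtain ⟨a, ha⟩ := FiniteField.exists_nonsquare (F := ZMod p) (by rwa [ZMod.ringChar_zmod_n])
  obtain ⟨ι⟩ : Nonempty (Fin n ↪ ZMod p × ZMod p) :=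
    Function.Embedding.nonempty_of_card_le (by simpa [ZMod.card, sq] using hn)
  have hcard : Fintype.card ((ZMod p × ZMod p) × ZMod p) = p ^ 3 := by
    simp [ZMod.card]; ring
  set e := Fintype.equivFinOfCardEq hcard
  have he : ∀ {s t}, (e s : ℕ) = e t → s = t := fun h => e.injective (Fin.ext h)
  refine ⟨fun u v => e (antipodalColor a (ι u) (ι v)), ⟨fun u v => ?_, fun u v w _ _ hvw h => ?_⟩,
    ?_, ?_⟩
  · exact congrArg (fun s => (e s : ℕ)) (antipodalColor_comm a _ _)
  · exact hvw (ι.injective (eq_of_antipodalColor_eq (he h)))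
  · refine (card_le_card (t := range (p ^ 3)) ?_).trans (card_range _).le
    intro k hk
    obtain ⟨q, -, rfl⟩ := mem_image.1 hk
    exact mem_range.2 (e _).2
  · rintro ⟨φ, hinj, hdisj, hcol⟩
    obtain ⟨u, v, w, huv, huw, hvw⟩ := hT.exists_adj_adj_ne hm
    rcases eq_or_eq_or_eq_of_antipodalColor ha (x := fun i => ι (φ i u))
      (y := fun i => ι (φ i v)) (z := fun i => ι (φ i w))
      (fun h => hvw (hinj 0 (ι.injective h)))
      (fun i j => he (hcol i j u v huv)) (fun i j => he (hcol i j u w huw)) with h | h | h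
    · exact hdisj 1 0 (by decide) u u (ι.injective h)
    · exact hdisj 2 0 (by decide) u u (ι.injective h)
    · exact hdisj 1 2 (by decide) u u (ι.injective h)

lemma rpow_three_halves_eq (n : ℕ) : (n : ℝ) ^ ((3 : ℝ) / 2) = n * √n := by
  rw [Real.sqrt_eq_rpow, ← Real.rpow_one_add' n.cast_nonneg (by norm_num)]
  norm_num

/-- For any tree `T` with at least two edges, `f₃(n,T) = Θ(n^{3/2})`:
there are constants `c₁, c₂ > 0` with `c₁·n^{3/2} ≤ f₃(n,T) ≤ c₂·n^{3/2}`
for all sufficiently large `n`. -/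
theorem stmt_7 (V : Type) [Fintype V] [DecidableEq V] (T : SimpleGraph V)
    [DecidableRel T.Adj] (hT : T.IsTree) (hm : 2 ≤ T.edgeFinset.card) :
    ∃ c₁ c₂ : ℝ, 0 < c₁ ∧ 0 < c₂ ∧ ∃ n₀ : ℕ, ∀ n ≥ n₀,
      c₁ * (n : ℝ) ^ ((3 : ℝ) / 2) ≤ (repeatNumber 3 n T : ℝ) ∧
        (repeatNumber 3 n T : ℝ) ≤ c₂ * (n : ℝ) ^ ((3 : ℝ) / 2) := by
  classical
  have := hT.connected.nonempty
  set D : ℕ := 9 * Fintype.card V with hD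
  have hDpos : 0 < D := by have := Fintype.card_pos (α := V); omega
  have hDR : (0 : ℝ) < D := by exact_mod_cast hDpos
  refine ⟨1 / (128 * D), 64, by positivity, by norm_num, 2, fun n hn => ?_⟩
  rw [rpow_three_halves_eq]
  have hnR : (2 : ℝ) ≤ n := by exact_mod_cast hn
  set r := Nat.sqrt n with hr
  have hr1 : 1 ≤ r := Nat.le_sqrt.2 (by omega)
  have hrn : n < (r + 1) ^ 2 := Nat.lt_succ_sqrt' n
  have hrs : (r : ℝ) ≤ √n := Real.nat_sqrt_le_real_sqrt
  have hr1R : (1 : ℝ) ≤ r := by exact_mod_cast hr1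
  have hspos : 0 < √(n : ℝ) := by positivity
  have hss : √(n : ℝ) * √n = n := Real.mul_self_sqrt n.cast_nonneg
  obtain ⟨p, hp, hrp, hpr⟩ := Nat.exists_prime_lt_and_le_two_mul (r + 1) (by omega)
  obtain ⟨c, hc, hcp, hrep⟩ := exists_coloring_not_hasRepeat hT hm hp (by omega)
    (hrn.le.trans (Nat.pow_le_pow_left hrp.le 2))
  constructor
  · obtain ⟨c', hc', hcol, hrep'⟩ : ∃ c, IsProperEdgeColoring n c ∧
        numColors n c = repeatNumber 3 n T ∧ ¬ HasRepeat n 3 T c :=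
      Nat.sInf_mem (s := { C | ∃ c : Fin n → Fin n → ℕ,
        IsProperEdgeColoring n c ∧ numColors n c = C ∧ ¬ HasRepeat n 3 T c })
        ⟨_, c, hc, rfl, hrep⟩
    rw [← hcol]
    set K := 8 * D * (r + 1) with hK
    have hK2 : 2 ≤ K := by nlinarith
    have h1 := card_tripleAdj_lower_bound hc' hK2
    have h2 := not_lt.1 fun h => hrep' (hasRepeat_of_card_tripleAdj hc' hT h)
    have h3 : K ^ 2 * (n * (n - 1)) ≤ 2 * D * n ^ 3 + 2 * K ^ 3 * numColors n c' :=
      h1.trans (Nat.add_le_add_right h2 _)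
    have h4 : (K : ℝ) ^ 2 * (n * (n - 1)) ≤ 2 * D * n ^ 3 + 2 * K ^ 3 * numColors n c' := by
      have : ((n - 1 : ℕ) : ℝ) = n - 1 := by push_cast [show 1 ≤ n by omega]; ring
      rw [← this]
      exact_mod_cast h3
    have hKR : (0 : ℝ) < K := by exact_mod_cast (by omega : 0 < K)
    have h5 : (8 : ℝ) * D * n ≤ K ^ 2 := by
      have : 8 * D * n ≤ K ^ 2 := by
        calc 8 * D * n ≤ (8 * D) ^ 2 * (r + 1) ^ 2 :=
              Nat.mul_le_mul (Nat.le_self_pow two_ne_zero _) hrn.le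
          _ = K ^ 2 := by rw [hK]; ring
      exact_mod_cast this
    have h6 : (K : ℝ) ≤ 16 * D * √n := by
      have : (K : ℝ) = 8 * D * (r + 1) := by rw [hK]; push_cast; ring
      rw [this]
      nlinarith
    set N : ℝ := ((numColors n c' : ℕ) : ℝ)
    have hN0 : 0 ≤ N := Nat.cast_nonneg _
    have h7 : (n : ℝ) ^ 2 ≤ 8 * K * N := by
      have e1 : (K : ℝ) ^ 2 * (n ^ 2 / 2) ≤ K ^ 2 * (n * (n - 1)) := by
        gcongr
        nlinarith
      have e2 : 2 * (D : ℝ) * n ^ 3 ≤ K ^ 2 * (n ^ 2 / 4) := by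
        have := mul_le_mul_of_nonneg_right h5 (by positivity : (0 : ℝ) ≤ n ^ 2 / 4)
        linarith
      have e3 : (K : ℝ) ^ 2 * n ^ 2 ≤ K ^ 2 * (8 * K * N) := by linarith
      exact le_of_mul_le_mul_left e3 (by positivity)
    have h8 : (n : ℝ) ^ 2 ≤ 128 * D * √n * N := by
      have := mul_le_mul_of_nonneg_right h6 hN0
      linarith
    have h9 : √(n : ℝ) * (n * √n) ≤ √n * (128 * D * N) := by
      calc √(n : ℝ) * (n * √n) = n * (√n * √n) := by ring
        _ = n ^ 2 := by rw [hss]; ring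
        _ ≤ _ := by linarith
    have h10 := le_of_mul_le_mul_left h9 hspos
    rw [one_div_mul_eq_div, div_le_iff₀ (by positivity)]
    linarith
  · have h0 : repeatNumber 3 n T ≤ numColors n c := Nat.sInf_le ⟨c, hc, rfl, hrep⟩
    have h1 : repeatNumber 3 n T ≤ p ^ 3 := h0.trans hcp
    have h2 : (p : ℝ) ≤ 4 * √n := by
      have : (p : ℝ) ≤ 2 * (r + 1) := by exact_mod_cast hpr
      linarith
    calc (repeatNumber 3 n T : ℝ) ≤ (p : ℝ) ^ 3 := by exact_mod_cast h1
      _ ≤ (4 * √n) ^ 3 := by gcongr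
      _ = 64 * ((√n * √n) * √n) := by ring
      _ = 64 * (n * √n) := by rw [hss]
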